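/- arXiv:math/9802126 — 4 statements merged into one kernel-verified Lean document; each statement's English description precedes it below -/
import Mathlib

section
/- Let Φ : ℤ^m → 𝒞 be a discrete frame with unit vectors s_j(t), and define the element spheres S_j(t) := Φ(t)⁻¹ e_j Φ(t+t_j). Then for every t ∈ ℤ^m and 1 ≤ j ≤ m: (i) S_j(t) is a vector of ℝ^{n+2} with S_j(t)² = −1 in 𝒞 (indeed S_j(t) = −Φ(t)⁻¹ s_j(t) Φ(t)); (ii) S_j(t) depends symmetrically on the two endpoints of the edge, i.e. Φ(t)⁻¹ e_j Φ(t+t_j) = Φ(t+t_j)⁻¹ e_j Φ(t); and (iii) consecutive points of the nets are obtained by inversion in the element sphere: F(t+t_j) = S_j(t) F(t) S_j(t) and F̂(t+t_j) = S_j(t) F̂(t) S_j(t). -/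
open CliffordAlgebra

noncomputable section

/-- Target Gram matrix of a pseudo-orthonormal basis `(e₀, e₁, …, e_n, e_∞)` of
Minkowski space `ℝ^{n+2}_1` (`e₀` at index `0`, `e_∞` at the last index):
`⟨e₀,e₀⟩ = ⟨e_∞,e_∞⟩ = 0`, `⟨e₀,e_∞⟩ = −1/2` (so that `e₀e_∞ + e_∞e₀ = 1` in the
Clifford algebra of `v ↦ −⟨v,v⟩`), `⟨e_i,e_i⟩ = 1` for `1 ≤ i ≤ n` (so `e_i² = −1`),
and all other products vanish (so distinct basis vectors anticommute). -/
def gram (n : ℕ) (i j : Fin (n + 2)) : ℝ :=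
  if (i = 0 ∧ j = Fin.last (n + 1)) ∨ (i = Fin.last (n + 1) ∧ j = 0) then -(1 / 2)
  else if i = j ∧ i ≠ 0 ∧ i ≠ Fin.last (n + 1) then 1
  else 0

/-- The quadratic form `v ↦ −⟨v,v⟩` associated to a bilinear form `B`. -/
def Qneg {V : Type*} [AddCommGroup V] [Module ℝ V]
    (B : LinearMap.BilinForm ℝ V) : QuadraticForm ℝ V :=
  -(LinearMap.BilinMap.toQuadraticMap B)

/-- The index in `Fin (n+2)` of the basis vector `e_j` for `1 ≤ j ≤ m ≤ n`
(`j : Fin m` denoting the `j`-th lattice direction). -/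
def idx {n m : ℕ} (hmn : m ≤ n) (j : Fin m) : Fin (n + 2) :=
  ⟨j.val + 1, by have := j.isLt; omega⟩

variable {n m : ℕ}

/-- `Φ : ℤ^m → 𝒞` is a discrete frame for the pseudo-orthonormal basis `e` and the
unit vectors `s_j(t)`: `Φ(0) = 1`, `s_j(t)² = −1` in `𝒞`, and
`Φ(t + t_j) = e_j · s_j(t) · Φ(t)`. -/
def IsDiscreteFrame (hmn : m ≤ n) (B : LinearMap.BilinForm ℝ (Fin (n + 2) → ℝ))
    (e : Fin (n + 2) → (Fin (n + 2) → ℝ))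
    (s : Fin m → (Fin m → ℤ) → (Fin (n + 2) → ℝ))
    (Φ : (Fin m → ℤ) → CliffordAlgebra (Qneg B)) : Prop :=
  Φ 0 = 1 ∧
  (∀ (j : Fin m) (t : Fin m → ℤ),
    ι (Qneg B) (s j t) * ι (Qneg B) (s j t) = -1) ∧
  (∀ (t : Fin m → ℤ) (j : Fin m),
    Φ (t + Pi.single j 1) = ι (Qneg B) (e (idx hmn j)) * ι (Qneg B) (s j t) * Φ t)

/-- The net `F(t) = Φ(t)⁻¹ e₀ Φ(t)`. -/
def Fnet (B : LinearMap.BilinForm ℝ (Fin (n + 2) → ℝ))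
    (e : Fin (n + 2) → (Fin (n + 2) → ℝ))
    (Φ : (Fin m → ℤ) → CliffordAlgebra (Qneg B)) (t : Fin m → ℤ) :
    CliffordAlgebra (Qneg B) :=
  Ring.inverse (Φ t) * ι (Qneg B) (e 0) * Φ t

/-- The net `F̂(t) = Φ(t)⁻¹ e_∞ Φ(t)`. -/
def Fhat (B : LinearMap.BilinForm ℝ (Fin (n + 2) → ℝ))
    (e : Fin (n + 2) → (Fin (n + 2) → ℝ))
    (Φ : (Fin m → ℤ) → CliffordAlgebra (Qneg B)) (t : Fin m → ℤ) :
    CliffordAlgebra (Qneg B) :=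
  Ring.inverse (Φ t) * ι (Qneg B) (e (Fin.last (n + 1))) * Φ t

/-- The element sphere `S_j(t) = Φ(t)⁻¹ e_j Φ(t + t_j)` attached to the edge from
`t` to `t + t_j`. -/
def Snet (hmn : m ≤ n) (B : LinearMap.BilinForm ℝ (Fin (n + 2) → ℝ))
    (e : Fin (n + 2) → (Fin (n + 2) → ℝ))
    (Φ : (Fin m → ℤ) → CliffordAlgebra (Qneg B)) (j : Fin m) (t : Fin m → ℤ) :
    CliffordAlgebra (Qneg B) :=
  Ring.inverse (Φ t) * ι (Qneg B) (e (idx hmn j)) * Φ (t + Pi.single j 1)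

theorem ι_Qneg_mul_self {V : Type*} [AddCommGroup V] [Module ℝ V]
    (B : LinearMap.BilinForm ℝ V) {v : V} (hv : B v v = 1) :
    ι (Qneg B) v * ι (Qneg B) v = -1 := by
  have hQ : Qneg B v = -1 := by simp [Qneg, hv]
  rw [ι_sq_scalar, hQ, map_neg, map_one]

theorem ι_Qneg_mul_mul_self_of_ortho {V : Type*} [AddCommGroup V] [Module ℝ V]
    (B : LinearMap.BilinForm ℝ V) {a b : V} (ha : B a a = 1) (hab : B a b = 0)
    (hba : B b a = 0) : ι (Qneg B) a * ι (Qneg B) b * ι (Qneg B) a = ι (Qneg B) b := by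
  have hpolar : QuadraticMap.polar (Qneg B) a b = 0 := by
    simp [QuadraticMap.polar, Qneg, hab, hba]
  have hQ : Qneg B a = -1 := by simp [Qneg, ha]
  rw [ι_mul_ι_mul_ι, hpolar, hQ]
  simp

theorem idx_ne_zero (hmn : m ≤ n) (j : Fin m) : idx hmn j ≠ 0 := by
  simp [idx, Fin.ext_iff]

theorem idx_ne_last (hmn : m ≤ n) (j : Fin m) : idx hmn j ≠ Fin.last (n + 1) := by
  have := j.isLt
  simp only [idx, ne_eq, Fin.ext_iff, Fin.val_last]
  omega

theorem gram_idx_self (hmn : m ≤ n) (j : Fin m) : gram n (idx hmn j) (idx hmn j) = 1 := by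
  simp [gram, idx_ne_zero, idx_ne_last]

theorem gram_eq_zero {i j : Fin (n + 2)} (h0 : i ≠ 0) (hlast : i ≠ Fin.last (n + 1))
    (hij : i ≠ j) : gram n i j = 0 ∧ gram n j i = 0 := by
  simp [gram, h0, hlast, hij, hij.symm]

/-- A square root of `-1`, viewed as a unit of the ambient ring. -/
def unitOfMulSelfEqNegOne {A : Type*} [Ring A] (x : A) (hx : x * x = -1) : Aˣ :=
  ⟨x, -x, by simp [hx], by simp [hx]⟩

theorem unitOfMulSelfEqNegOne_mem_lipschitzGroup {R M : Type*} [CommRing R] [AddCommGroup M]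
    [Module R M] {Q : QuadraticForm R M} {v : M} (hv : ι Q v * ι Q v = -1) :
    unitOfMulSelfEqNegOne (ι Q v) hv ∈ lipschitzGroup Q :=
  Subgroup.subset_closure ⟨v, rfl⟩

theorem forall_of_add_single_iff {ι : Type*} [Fintype ι] [DecidableEq ι] {P : (ι → ℤ) → Prop}
    (h0 : P 0) (hstep : ∀ t i, P (t + Pi.single i 1) ↔ P t) (t : ι → ℤ) : P t := by
  let H : AddSubgroup (ι → ℤ) :=
    { carrier := {v | ∀ t, P (t + v) ↔ P t}
      zero_mem' := fun t => by simp
      add_mem' := fun {a b} ha hb t => by rw [← add_assoc, hb, ha]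
      neg_mem' := fun {a} ha t => by rw [← ha (t + -a), neg_add_cancel_right] }
  have ht : t ∈ H := by
    rw [← Finset.univ_sum_single t]
    refine H.sum_mem fun i _ => ?_
    have hi : Pi.single i (t i) = t i • (Pi.single i 1 : ι → ℤ) := by
      rw [← Pi.single_smul]; simp
    rw [hi]
    exact H.zsmul_mem (fun t => hstep t i) _
  simpa using (ht 0).2 (by simpa using h0)

theorem IsDiscreteFrame.exists_mem_lipschitzGroup {hmn : m ≤ n}
    {B : LinearMap.BilinForm ℝ (Fin (n + 2) → ℝ)} {e : Fin (n + 2) → (Fin (n + 2) → ℝ)}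
    {s : Fin m → (Fin m → ℤ) → (Fin (n + 2) → ℝ)}
    {Φ : (Fin m → ℤ) → CliffordAlgebra (Qneg B)} (hframe : IsDiscreteFrame hmn B e s Φ)
    (hgram : ∀ i j, B (e i) (e j) = gram n i j) (t : Fin m → ℤ) :
    ∃ u ∈ lipschitzGroup (Qneg B), (u : CliffordAlgebra (Qneg B)) = Φ t := by
  obtain ⟨hzero, hs, hstep⟩ := hframe
  refine forall_of_add_single_iff
    (P := fun t => ∃ u ∈ lipschitzGroup (Qneg B), (u : CliffordAlgebra (Qneg B)) = Φ t)
    ⟨1, one_mem _, by simp [hzero]⟩ (fun t j => ?_) t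
  have he : ι (Qneg B) (e (idx hmn j)) * ι (Qneg B) (e (idx hmn j)) = -1 :=
    ι_Qneg_mul_self B (by rw [hgram, gram_idx_self])
  let w := unitOfMulSelfEqNegOne _ he * unitOfMulSelfEqNegOne _ (hs j t)
  have hw : w ∈ lipschitzGroup (Qneg B) :=
    mul_mem (unitOfMulSelfEqNegOne_mem_lipschitzGroup he)
      (unitOfMulSelfEqNegOne_mem_lipschitzGroup (hs j t))
  have hΦ : Φ (t + Pi.single j 1) = w * Φ t := hstep t j
  constructor
  · rintro ⟨u, hu, huΦ⟩
    exact ⟨w⁻¹ * u, mul_mem (inv_mem hw) hu, by rw [Units.val_mul, huΦ, hΦ]; simp⟩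
  · rintro ⟨u, hu, huΦ⟩
    exact ⟨w * u, mul_mem hw hu, by rw [Units.val_mul, huΦ, hΦ]⟩

theorem inverse_mul_ι_mul_mem_range {R M : Type*} [CommRing R] [Invertible (2 : R)]
    [AddCommGroup M] [Module R M] {Q : QuadraticForm R M} {u : (CliffordAlgebra Q)ˣ}
    (hu : u ∈ lipschitzGroup Q) (v : M) :
    (↑u⁻¹ * ι Q v * u : CliffordAlgebra Q) ∈ LinearMap.range (ι Q) := by
  simpa [ConjAct.units_smul_def] using
    lipschitzGroup.conjAct_smul_ι_mem_range_ι (inv_mem hu) v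

theorem inverse_mul_mul_unit {A : Type*} [Ring A] {x y : A} (hx : x * x = -1)
    (hy : y * y = -1) (u : Aˣ) : Ring.inverse (x * y * u) = ↑u⁻¹ * y * x := by
  have h : x * y * u =
      ↑(unitOfMulSelfEqNegOne x hx * unitOfMulSelfEqNegOne y hy * u) := rfl
  rw [h, Ring.inverse_unit, mul_inv_rev, mul_inv_rev]
  simp [unitOfMulSelfEqNegOne, mul_assoc]

theorem inverse_mul_mul_conj {A : Type*} [Ring A] {x y z : A} (hx : x * x = -1)
    (hy : y * y = -1) (hxz : x * z * x = z) (u : Aˣ) :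
    Ring.inverse (x * y * u) * z * (x * y * u) =
      -(↑u⁻¹ * y * u) * (↑u⁻¹ * z * u) * -(↑u⁻¹ * y * u) := by
  rw [inverse_mul_mul_unit hx hy]
  calc ↑u⁻¹ * y * x * z * (x * y * u) = ↑u⁻¹ * y * (x * z * x) * y * u := by
        simp only [mul_assoc]
    _ = _ := by simp [hxz, mul_assoc]

/-- For a discrete frame `Φ` with unit vectors `s_j(t)` and element
spheres `S_j(t) := Φ(t)⁻¹ e_j Φ(t+t_j)`:
(i) `S_j(t)` is a vector of `ℝ^{n+2}` with `S_j(t)² = −1`, and indeed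
`S_j(t) = −Φ(t)⁻¹ s_j(t) Φ(t)`;
(ii) `S_j(t)` depends symmetrically on the endpoints of the edge:
`Φ(t)⁻¹ e_j Φ(t+t_j) = Φ(t+t_j)⁻¹ e_j Φ(t)`;
(iii) consecutive points of the nets are obtained by inversion in the element sphere:
`F(t+t_j) = S_j(t) F(t) S_j(t)` and `F̂(t+t_j) = S_j(t) F̂(t) S_j(t)`. -/
theorem stmt9 {n m : ℕ} (hm : 1 ≤ m) (hmn : m ≤ n)
    (B : LinearMap.BilinForm ℝ (Fin (n + 2) → ℝ)) (hsymm : ∀ u v, B u v = B v u)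
    (e : Fin (n + 2) → (Fin (n + 2) → ℝ)) (he : LinearIndependent ℝ e)
    (hgram : ∀ i j, B (e i) (e j) = gram n i j)
    (s : Fin m → (Fin m → ℤ) → (Fin (n + 2) → ℝ))
    (Φ : (Fin m → ℤ) → CliffordAlgebra (Qneg B))
    (hframe : IsDiscreteFrame hmn B e s Φ)
    (t : Fin m → ℤ) (j : Fin m) :
    (∃ v : Fin (n + 2) → ℝ, ι (Qneg B) v = Snet hmn B e Φ j t) ∧
    Snet hmn B e Φ j t * Snet hmn B e Φ j t = -1 ∧
    Snet hmn B e Φ j t = -(Ring.inverse (Φ t) * ι (Qneg B) (s j t) * Φ t) ∧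
    Snet hmn B e Φ j t =
      Ring.inverse (Φ (t + Pi.single j 1)) * ι (Qneg B) (e (idx hmn j)) * Φ t ∧
    Fnet B e Φ (t + Pi.single j 1) = Snet hmn B e Φ j t * Fnet B e Φ t * Snet hmn B e Φ j t ∧
    Fhat B e Φ (t + Pi.single j 1) = Snet hmn B e Φ j t * Fhat B e Φ t * Snet hmn B e Φ j t := by
  obtain ⟨u, hu, huΦ⟩ := hframe.exists_mem_lipschitzGroup hgram t
  obtain ⟨-, hs, hstep⟩ := hframe
  have hee : B (e (idx hmn j)) (e (idx hmn j)) = 1 := by rw [hgram, gram_idx_self]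
  have hx := ι_Qneg_mul_self B hee
  have hy := hs j t
  have hne_zero := idx_ne_zero hmn j
  have hne_last := idx_ne_last hmn j
  have hfix : ∀ i, idx hmn j ≠ i → ι (Qneg B) (e (idx hmn j)) * ι (Qneg B) (e i) *
      ι (Qneg B) (e (idx hmn j)) = ι (Qneg B) (e i) := fun i hi =>
    ι_Qneg_mul_mul_self_of_ortho B hee
      (by rw [hgram, (gram_eq_zero hne_zero hne_last hi).1])
      (by rw [hgram, (gram_eq_zero hne_zero hne_last hi).2])
  have hS : Snet hmn B e Φ j t = -(↑u⁻¹ * ι (Qneg B) (s j t) * u) := by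
    rw [Snet, hstep, ← huΦ, Ring.inverse_unit]
    calc ↑u⁻¹ * ι (Qneg B) (e (idx hmn j)) *
          (ι (Qneg B) (e (idx hmn j)) * ι (Qneg B) (s j t) * u)
        = ↑u⁻¹ * (ι (Qneg B) (e (idx hmn j)) * ι (Qneg B) (e (idx hmn j))) *
          ι (Qneg B) (s j t) * u := by simp only [mul_assoc]
      _ = _ := by simp [hx]
  refine ⟨?_, ?_, ?_, ?_, ?_, ?_⟩
  · rw [hS]
    exact neg_mem (inverse_mul_ι_mul_mem_range hu (s j t))
  · rw [hS]
    calc -(↑u⁻¹ * ι (Qneg B) (s j t) * u) * -(↑u⁻¹ * ι (Qneg B) (s j t) * u)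
        = ↑u⁻¹ * (ι (Qneg B) (s j t) * ι (Qneg B) (s j t)) * u := by
          simp only [neg_mul_neg, mul_assoc, Units.mul_inv_cancel_left]
      _ = -1 := by simp [hy]
  · rw [hS, ← huΦ, Ring.inverse_unit]
  · rw [hS, hstep, ← huΦ, inverse_mul_mul_unit hx hy,
      mul_assoc _ (ι (Qneg B) (e (idx hmn j))) (ι (Qneg B) (e (idx hmn j))), hx]
    simp
  · rw [hS, Fnet, Fnet, hstep, ← huΦ, Ring.inverse_unit]
    exact inverse_mul_mul_conj hx hy (hfix _ hne_zero) u
  · rw [hS, Fhat, Fhat, hstep, ← huΦ, Ring.inverse_unit]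
    exact inverse_mul_mul_conj hx hy (hfix _ hne_last) u
end
end

section
/- Let Φ : ℤ^m → 𝒞 be a discrete frame with associated nets F and F̂. Then for every t ∈ ℤ^m and 1 ≤ j ≤ m, the four isotropic vectors F(t), F̂(t), F(t+t_j), F̂(t+t_j) are linearly dependent in ℝ^{n+2}; that is, the endpoints of corresponding edges of the two nets F and F̂ are concircular points of the conformal n-sphere. -/
open CliffordAlgebra

noncomputable section

variable {n m : ℕ}

section Clifford

variable {V : Type*} [AddCommGroup V] [Module ℝ V] {Q : QuadraticForm ℝ V}

/-- A vector squaring to `-1` in the Clifford algebra, as a unit. -/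
def unitOfSqNegOne (v : V) (hv : ι Q v * ι Q v = -1) : (CliffordAlgebra Q)ˣ where
  val := ι Q v
  inv := -ι Q v
  val_inv := by rw [mul_neg, hv, neg_neg]
  inv_val := by rw [neg_mul, hv, neg_neg]

theorem unitOfSqNegOne_mem_lipschitzGroup (v : V) (hv : ι Q v * ι Q v = -1) :
    unitOfSqNegOne v hv ∈ lipschitzGroup Q :=
  Subgroup.subset_closure ⟨v, rfl⟩

theorem exists_ι_eq_inv_mul_ι_mul {a : (CliffordAlgebra Q)ˣ} (ha : a ∈ lipschitzGroup Q)
    (v : V) : ∃ w, ι Q w = ↑a⁻¹ * ι Q v * ↑a := by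
  have h := lipschitzGroup.conjAct_smul_ι_mem_range_ι (inv_mem ha) v
  rwa [ConjAct.units_smul_def, ConjAct.ofConjAct_toConjAct, inv_inv] at h

/-- Conjugating `v` by the product of a unit vector `u` orthogonal to `v` and a unit vector `s`
adds a multiple of `s` to `v`. -/
theorem ι_mul_ι_mul_ι_mul_ι_mul_ι {u s v : V} (hu : ι Q u * ι Q u = -1)
    (hs : ι Q s * ι Q s = -1) (huv : QuadraticMap.polar Q u v = 0) :
    ι Q s * ι Q u * ι Q v * (ι Q u * ι Q s) = ι Q (v + QuadraticMap.polar Q s v • s) := by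
  have huvu : ι Q u * ι Q v * ι Q u = ι Q v := by
    rw [ι_mul_ι_comm, huv, map_zero, zero_sub, neg_mul, mul_assoc, hu, mul_neg_one, neg_neg]
  calc ι Q s * ι Q u * ι Q v * (ι Q u * ι Q s)
      = ι Q s * (ι Q u * ι Q v * ι Q u) * ι Q s := by simp only [mul_assoc]
    _ = ι Q (v + QuadraticMap.polar Q s v • s) := by
      rw [huvu, ι_mul_ι_comm, sub_mul, mul_assoc, hs, ← Algebra.smul_def, map_add, map_smul,
        mul_neg_one, sub_neg_eq_add, add_comm]

theorem inverse_mul_ι_mul_eq {u s v : V} (hu : ι Q u * ι Q u = -1)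
    (hs : ι Q s * ι Q s = -1) (huv : QuadraticMap.polar Q u v = 0) (a : (CliffordAlgebra Q)ˣ) :
    Ring.inverse (ι Q u * ι Q s * a) * ι Q v * (ι Q u * ι Q s * a) =
      ↑a⁻¹ * ι Q (v + QuadraticMap.polar Q s v • s) * a := by
  have hinv : Ring.inverse (ι Q u * ι Q s * (a : CliffordAlgebra Q)) =
      ↑a⁻¹ * (ι Q s * ι Q u) := by
    change Ring.inverse ((unitOfSqNegOne u hu * unitOfSqNegOne s hs * a :
      (CliffordAlgebra Q)ˣ) : CliffordAlgebra Q) = _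
    rw [Ring.inverse_unit, mul_inv_rev, mul_inv_rev]
    change ↑a⁻¹ * (-ι Q s * -ι Q u) = _
    rw [neg_mul_neg]
  rw [hinv, ← ι_mul_ι_mul_ι_mul_ι_mul_ι hu hs huv]
  simp only [mul_assoc]

end Clifford

theorem polar_Qneg {V : Type*} [AddCommGroup V] [Module ℝ V] (B : LinearMap.BilinForm ℝ V)
    (u v : V) : QuadraticMap.polar (Qneg B) u v = -(B u v + B v u) := by
  simp only [Qneg, QuadraticMap.polar, neg_apply, LinearMap.BilinMap.toQuadraticMap_apply,
    map_add, LinearMap.add_apply]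
  ring

/-- A set of lattice points containing `0` and stable under unit steps in both directions is the
whole lattice. -/
theorem lattice_induction {P : (Fin m → ℤ) → Prop} (zero : P 0)
    (step : ∀ t j, P (t + Pi.single j 1) ↔ P t) (t : Fin m → ℤ) : P t := by
  have shift : ∀ (k : ℤ) (t : Fin m → ℤ) (j : Fin m), P (t + Pi.single j k) ↔ P t := by
    intro k
    induction k with
    | zero => simp
    | succ i ih =>
      intro t j
      rw [Pi.single_add, ← add_assoc, step, ih]
    | pred i ih =>
      intro t j
      rw [← step, add_assoc, ← Pi.single_add, sub_add_cancel, ih]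
  have sum_mem : ∀ S : Finset (Fin m), P (∑ j ∈ S, Pi.single j (t j)) := by
    intro S
    induction S using Finset.induction_on with
    | empty => simpa using zero
    | insert j S hj ih => rwa [Finset.sum_insert hj, add_comm, shift]
  simpa only [Finset.univ_sum_single] using sum_mem Finset.univ

theorem IsDiscreteFrame.exists_lipschitzGroup {hmn : m ≤ n}
    {B : LinearMap.BilinForm ℝ (Fin (n + 2) → ℝ)} {e : Fin (n + 2) → (Fin (n + 2) → ℝ)}
    {s : Fin m → (Fin m → ℤ) → (Fin (n + 2) → ℝ)}
    {Φ : (Fin m → ℤ) → CliffordAlgebra (Qneg B)} (hframe : IsDiscreteFrame hmn B e s Φ)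
    (he : ∀ j, ι (Qneg B) (e (idx hmn j)) * ι (Qneg B) (e (idx hmn j)) = -1)
    (t : Fin m → ℤ) : ∃ a ∈ lipschitzGroup (Qneg B), (a : CliffordAlgebra (Qneg B)) = Φ t := by
  obtain ⟨hzero, hs, hstep⟩ := hframe
  induction t using lattice_induction with
  | zero => exact ⟨1, one_mem _, hzero.symm⟩
  | step t j =>
    set g := unitOfSqNegOne _ (he j) * unitOfSqNegOne _ (hs j t)
    have hmem : g ∈ lipschitzGroup (Qneg B) :=
      mul_mem (unitOfSqNegOne_mem_lipschitzGroup _ _) (unitOfSqNegOne_mem_lipschitzGroup _ _)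
    have hΦ : Φ (t + Pi.single j 1) = g * Φ t := hstep t j
    rw [hΦ]
    constructor
    · rintro ⟨a, ha, hat⟩
      exact ⟨g⁻¹ * a, mul_mem (inv_mem hmem) ha, by
        rw [Units.val_mul, hat, Units.inv_mul_cancel_left]⟩
    · rintro ⟨a, ha, hat⟩
      exact ⟨g * a, mul_mem hmem ha, by rw [Units.val_mul, hat]⟩

/-- Two vectors together with their translates along a common direction are linearly
dependent. -/
theorem not_linearIndependent_translates {V : Type*} [AddCommGroup V] [Module ℝ V]
    (x y w : V) (p q : ℝ) : ¬ LinearIndependent ℝ ![x, y, x + p • w, y + q • w] := by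
  intro h
  rw [Fintype.linearIndependent_iff] at h
  have hq := h ![q, -p, -q, p] (by simp [Fin.sum_univ_four]; module)
  obtain rfl : q = 0 := by simpa using hq 0
  obtain rfl : p = 0 := by simpa using hq 3
  have hone := h ![1, 0, -1, 0] (by simp [Fin.sum_univ_four]) 0
  simp at hone

/-- For a discrete frame `Φ` with associated nets `F` and `F̂`,
the four isotropic vectors `F(t), F̂(t), F(t+t_j), F̂(t+t_j)` are linearly dependent
vectors of `ℝ^{n+2}`: the endpoints of corresponding edges of the two nets are
concircular points of the conformal `n`-sphere. -/
theorem stmt10 {n m : ℕ} (hm : 1 ≤ m) (hmn : m ≤ n)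
    (B : LinearMap.BilinForm ℝ (Fin (n + 2) → ℝ)) (hsymm : ∀ u v, B u v = B v u)
    (e : Fin (n + 2) → (Fin (n + 2) → ℝ)) (he : LinearIndependent ℝ e)
    (hgram : ∀ i j, B (e i) (e j) = gram n i j)
    (s : Fin m → (Fin m → ℤ) → (Fin (n + 2) → ℝ))
    (Φ : (Fin m → ℤ) → CliffordAlgebra (Qneg B))
    (hframe : IsDiscreteFrame hmn B e s Φ)
    (t : Fin m → ℤ) (j : Fin m) :
    ∃ v : Fin 4 → (Fin (n + 2) → ℝ),
      ι (Qneg B) (v 0) = Fnet B e Φ t ∧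
      ι (Qneg B) (v 1) = Fhat B e Φ t ∧
      ι (Qneg B) (v 2) = Fnet B e Φ (t + Pi.single j 1) ∧
      ι (Qneg B) (v 3) = Fhat B e Φ (t + Pi.single j 1) ∧
      ¬ LinearIndependent ℝ v := by
  have hej : ∀ j, ι (Qneg B) (e (idx hmn j)) * ι (Qneg B) (e (idx hmn j)) = -1 := by
    intro j
    have hQ : Qneg B (e (idx hmn j)) = -1 := by
      simp [Qneg, hgram, gram, idx_ne_zero, idx_ne_last]
    rw [ι_sq_scalar, hQ, map_neg, map_one]
  have horth₀ : QuadraticMap.polar (Qneg B) (e (idx hmn j)) (e 0) = 0 := by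
    rw [polar_Qneg, hsymm (e 0)]
    simp [hgram, gram, idx_ne_zero, idx_ne_last]
  have horth_last :
      QuadraticMap.polar (Qneg B) (e (idx hmn j)) (e (Fin.last (n + 1))) = 0 := by
    rw [polar_Qneg, hsymm (e (Fin.last (n + 1)))]
    simp [hgram, gram, idx_ne_zero, idx_ne_last]
  obtain ⟨a, ha, hat⟩ := hframe.exists_lipschitzGroup hej t
  obtain ⟨-, hs, hstep⟩ := hframe
  obtain ⟨x, hx⟩ := exists_ι_eq_inv_mul_ι_mul ha (e 0)
  obtain ⟨y, hy⟩ := exists_ι_eq_inv_mul_ι_mul ha (e (Fin.last (n + 1)))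
  obtain ⟨w, hw⟩ := exists_ι_eq_inv_mul_ι_mul ha (s j t)
  refine ⟨_, ?_, ?_, ?_, ?_, not_linearIndependent_translates x y w
    (QuadraticMap.polar (Qneg B) (s j t) (e 0))
    (QuadraticMap.polar (Qneg B) (s j t) (e (Fin.last (n + 1))))⟩
  · simp [Fnet, ← hat, hx]
  · simp [Fhat, ← hat, hy]
  · rw [Fnet, hstep, ← hat, inverse_mul_ι_mul_eq (hej j) (hs j t) horth₀]
    simp [hx, hw, mul_add, add_mul]
  · rw [Fhat, hstep, ← hat, inverse_mul_ι_mul_eq (hej j) (hs j t) horth_last]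
    simp [hy, hw, mul_add, add_mul]
end
end

section
/- Let Φ : ℤ^m → 𝒞 be a discrete frame with unit vectors s_j(t), and fix t ∈ ℤ^m and 1 ≤ i ≠ j ≤ m with ⟨e₀, s_j(t)⟩ · ⟨e₀, s_j(t+t_i)⟩ ≠ 0. Set (q₁, q₂, q₃, q₄) := (F(t), F(t+t_i), F(t+t_i+t_j), F(t+t_j)), the vertices of an elementary quadrilateral of the net F. Then their cross ratio is the real number DV[q₁,q₂,q₃,q₄] = −(⟨e₀, s_i(t)⟩⟨e₀, s_i(t+t_j)⟩)/(⟨e₀, s_j(t)⟩⟨e₀, s_j(t+t_i)⟩); explicitly, in 𝒞, ⟨e₀, s_j(t)⟩⟨e₀, s_j(t+t_i)⟩ · (q₁q₂q₃q₄ + q₄q₃q₂q₁) = −⟨e₀, s_i(t)⟩⟨e₀, s_i(t+t_j)⟩ · (q₁q₄ + q₄q₁)(q₂q₃ + q₃q₂). -/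
open CliffordAlgebra

noncomputable section

variable {n m : ℕ}

/-- In the Clifford algebra of `v ↦ -⟨v,v⟩`, `uv = -vu - 2⟨u,v⟩`. -/
theorem ι_Qneg_mul_comm {V : Type*} [AddCommGroup V] [Module ℝ V]
    (B : LinearMap.BilinForm ℝ V) (hsymm : ∀ u v, B u v = B v u) (u v : V) :
    ι (Qneg B) u * ι (Qneg B) v =
      -(ι (Qneg B) v * ι (Qneg B) u) - (2 * B u v) • (1 : CliffordAlgebra (Qneg B)) := by
  have h := ι_mul_ι_add_swap (Q := Qneg B) u v
  have hp : QuadraticMap.polar (Qneg B) u v = -(2 * B u v) := by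
    simp only [QuadraticMap.polar, Qneg, neg_apply,
      LinearMap.BilinMap.toQuadraticMap_apply, map_add, LinearMap.add_apply, hsymm v u]
    ring
  rw [hp, Algebra.algebraMap_eq_smul_one, neg_smul] at h
  rw [sub_eq_add_neg, ← h]
  abel

theorem ι_Qneg_sq {V : Type*} [AddCommGroup V] [Module ℝ V]
    (B : LinearMap.BilinForm ℝ V) (v : V) :
    ι (Qneg B) v * ι (Qneg B) v = -(B v v • (1 : CliffordAlgebra (Qneg B))) := by
  have h : Qneg B v = -(B v v) := rfl
  rw [ι_sq_scalar, Algebra.algebraMap_eq_smul_one, h, neg_smul]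

section Algebraic

variable {A : Type*} [Ring A] [Algebra ℝ A]

theorem isotropic_sandwich {o r : A} {ρ : ℝ} (ho : o * o = 0)
    (hor : o * r = -(r * o) - (2 * ρ) • 1) : o * r * o = (-2 * ρ) • o := by
  rw [hor, sub_mul, neg_mul, mul_assoc, ho, smul_mul_assoc, one_mul]
  simp [neg_smul]

theorem reflect_isotropic {o r : A} {ρ : ℝ} (hr : r * r = -1)
    (hor : o * r = -(r * o) - (2 * ρ) • 1) : r * o * r = o - (2 * ρ) • r := by
  rw [mul_assoc, hor, mul_sub, mul_neg, ← mul_assoc, hr]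
  simp

theorem isotropic_mul_reflect {o r : A} {ρ : ℝ} (ho : o * o = 0) (hr : r * r = -1)
    (hor : o * r = -(r * o) - (2 * ρ) • 1) : o * (r * o * r) = (-2 * ρ) • (o * r) := by
  rw [reflect_isotropic hr hor, mul_sub, ho]
  simp [neg_smul]

theorem reflect_mul_isotropic {o r : A} {ρ : ℝ} (ho : o * o = 0) (hr : r * r = -1)
    (hor : o * r = -(r * o) - (2 * ρ) • 1) : (r * o * r) * o = (-2 * ρ) • (r * o) := by
  rw [reflect_isotropic hr hor, sub_mul, ho]
  simp [neg_smul]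

theorem isotropic_reflect_anticommutator {o r : A} {ρ : ℝ} (ho : o * o = 0) (hr : r * r = -1)
    (hor : o * r = -(r * o) - (2 * ρ) • 1) :
    o * (r * o * r) + (r * o * r) * o = (4 * ρ ^ 2) • 1 := by
  rw [isotropic_mul_reflect ho hr hor, reflect_mul_isotropic ho hr hor, hor]
  module

theorem edge_anticommutator {o a s r : A} {ρ : ℝ} (ho : o * o = 0) (ha : a * a = -1)
    (hao : a * o = -(o * a)) (hs : s * s = -1) (hr : r * r = -1)
    (hor : o * r = -(r * o) - (2 * ρ) • 1) :
    (s * o * s) * (s * a * (r * o * r) * a * s) + (s * a * (r * o * r) * a * s) * (s * o * s) =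
      (4 * ρ ^ 2) • 1 := by
  have h : (s * o * s) * (s * a * (r * o * r) * a * s) +
      (s * a * (r * o * r) * a * s) * (s * o * s) =
      s * a * (o * (r * o * r) + (r * o * r) * o) * a * s := by
    generalize r * o * r = x
    linear_combination (norm := noncomm_ring)
      s * o * hs * a * x * a * s - s * hao * x * a * s + s * a * x * a * hs * o * s
        - s * a * x * hao * s
  rw [h, isotropic_reflect_anticommutator ho hr hor]
  have h1 : s * a * a * s = 1 := by
    linear_combination (norm := noncomm_ring) s * ha * s - hs
  simp [h1]

/-- The product of the four vertices of an elementary quadrilateral, transported to a frame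
in which the first vertex is `o`. -/
theorem quadrilateral_product {o a b s r s' r' : A} {σ σ' ρ' : ℝ}
    (ho : o * o = 0) (ha : a * a = -1) (hb : b * b = -1)
    (hao : a * o = -(o * a)) (hbo : b * o = -(o * b)) (hba : b * a = -(a * b))
    (hs : s * s = -1) (hr : r * r = -1) (hs' : s' * s' = -1) (hr' : r' * r' = -1)
    (hos : o * s = -(s * o) - (2 * σ) • 1) (hos' : o * s' = -(s' * o) - (2 * σ') • 1)
    (hor' : o * r' = -(r' * o) - (2 * ρ') • 1)
    (hcomp : b * r' * a * s = a * s' * b * r) :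
    o * (s * o * s) * (r * b * (s' * o * s') * b * r) * (r * o * r) =
      (8 * σ * σ' * ρ') • (o * r) := by
  have hinv : r * b * s' * a = s * a * r' * b := by
    have h1 : (s * a * r' * b) * (b * r' * a * s) = 1 := by
      linear_combination (norm := noncomm_ring)
        s * a * r' * hb * r' * a * s - s * a * hr' * a * s + s * ha * s - hs
    have h2 : (a * s' * b * r) * (r * b * s' * a) = 1 := by
      linear_combination (norm := noncomm_ring)
        a * s' * b * hr * b * s' * a - a * s' * hb * s' * a + a * hs' * a - ha
    rw [← hcomp] at h2
    exact (left_inv_eq_right_inv h1 h2).symm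
  have h12 := isotropic_mul_reflect ho hs hos
  have h34 : (r * b * (s' * o * s') * b * r) * (r * o * r) =
      (-2 * σ') • (r * b * s' * o * b * r) := by
    have h := reflect_mul_isotropic ho hs' hos'
    calc (r * b * (s' * o * s') * b * r) * (r * o * r)
        = r * b * ((s' * o * s') * o) * b * r := by
          linear_combination (norm := noncomm_ring)
            r * b * (s' * o * s') * b * hr * o * r - r * b * (s' * o * s') * hbo * r
      _ = _ := by rw [h]; simp [mul_assoc]
  have hsrbs : s * (r * b * s') = a * r' * b * a := by
    linear_combination (norm := noncomm_ring)
      s * r * b * s' * ha - s * hinv * a - hs * a * r' * b * a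
  have hsand := isotropic_sandwich ho hor'
  have hmid : o * (s * (r * b * s')) * o * b * r = (2 * ρ') • (o * r) := by
    rw [hsrbs]
    calc o * (a * r' * b * a) * o * b * r = -(a * (o * r' * o) * b * a * b * r) := by
          linear_combination (norm := noncomm_ring)
            o * a * r' * b * hao * b * r - o * a * r' * hbo * a * b * r
              + hao * r' * o * b * a * b * r
      _ = (2 * ρ') • (a * o * b * a * b * r) := by rw [hsand]; simp [mul_assoc, neg_smul]
      _ = (2 * ρ') • (o * r) := by
          congr 1
          linear_combination (norm := noncomm_ring)
            a * o * hba * b * r - a * o * a * hb * r + hao * a * r - o * ha * r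
  rw [mul_assoc _ (r * b * (s' * o * s') * b * r), h34, h12, smul_mul_smul_comm]
  have : o * s * (r * b * s' * o * b * r) = o * (s * (r * b * s')) * o * b * r := by
    simp only [mul_assoc]
  rw [this, hmid, smul_smul]
  congr 1
  ring

end Algebraic

/-- A map on `ℤ^m` with value `1` at the origin and invertible transitions along lattice edges has
invertible values. -/
theorem isUnit_of_step {m : ℕ} {A : Type*} [Monoid A] (Φ : (Fin m → ℤ) → A) (h0 : Φ 0 = 1)
    (hstep : ∀ t j, ∃ g : Aˣ, Φ (t + Pi.single j 1) = g * Φ t) (t : Fin m → ℤ) :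
    IsUnit (Φ t) := by
  have step : ∀ t j, IsUnit (Φ (t + Pi.single j 1)) ↔ IsUnit (Φ t) := fun t j => by
    obtain ⟨g, hg⟩ := hstep t j
    rw [hg, Units.isUnit_units_mul]
  have steps : ∀ (j : Fin m) (k : ℤ) (t : Fin m → ℤ),
      IsUnit (Φ (t + Pi.single j k)) ↔ IsUnit (Φ t) := by
    intro j k
    induction k using Int.induction_on with
    | zero => simp
    | succ k ih =>
      intro t
      rw [Pi.single_add, ← add_assoc, step, ih]
    | pred k ih =>
      intro t
      rw [← step, add_assoc, ← Pi.single_add, sub_add_cancel, ih]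
  have sums : ∀ S : Finset (Fin m), IsUnit (Φ (∑ j ∈ S, Pi.single j (t j))) := by
    intro S
    induction S using Finset.induction_on with
    | empty => simp [h0]
    | insert j S hj ih => rwa [Finset.sum_insert hj, add_comm, steps]
  simpa [Finset.univ_sum_single] using sums Finset.univ

/-- The net at a point whose frame differs from that at `t` by an invertible factor. -/
theorem Fnet_eq_conj {n m : ℕ} (B : LinearMap.BilinForm ℝ (Fin (n + 2) → ℝ))
    (e : Fin (n + 2) → (Fin (n + 2) → ℝ)) (Φ : (Fin m → ℤ) → CliffordAlgebra (Qneg B))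
    {t t' : Fin m → ℤ} (u : (CliffordAlgebra (Qneg B))ˣ) (hu : Φ t = u)
    {g g' : CliffordAlgebra (Qneg B)} (hgg' : g * g' = 1) (hg'g : g' * g = 1)
    (ht' : Φ t' = g * Φ t) :
    Fnet B e Φ t' = ↑u⁻¹ * (g' * ι (Qneg B) (e 0) * g) * u := by
  have h : Φ t' = ((⟨g, g', hgg', hg'g⟩ * u : (CliffordAlgebra (Qneg B))ˣ) :
      CliffordAlgebra (Qneg B)) := by rw [ht', hu]; rfl
  rw [Fnet, h, Ring.inverse_unit, mul_inv_rev]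
  simp [mul_assoc]

/-- For a discrete frame `Φ`, `i ≠ j`, and
`⟨e₀,s_j(t)⟩⟨e₀,s_j(t+t_i)⟩ ≠ 0`, the cross ratio of the vertices
`(q₁,q₂,q₃,q₄) := (F(t), F(t+t_i), F(t+t_i+t_j), F(t+t_j))` of an elementary
quadrilateral of the net `F` is the real number
`−(⟨e₀,s_i(t)⟩⟨e₀,s_i(t+t_j)⟩)/(⟨e₀,s_j(t)⟩⟨e₀,s_j(t+t_i)⟩)`; explicitly, in `𝒞`,
`⟨e₀,s_j(t)⟩⟨e₀,s_j(t+t_i)⟩ • (q₁q₂q₃q₄ + q₄q₃q₂q₁)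
  = −⟨e₀,s_i(t)⟩⟨e₀,s_i(t+t_j)⟩ • (q₁q₄+q₄q₁)(q₂q₃+q₃q₂)`. -/
theorem stmt12 {n m : ℕ} (hm : 1 ≤ m) (hmn : m ≤ n)
    (B : LinearMap.BilinForm ℝ (Fin (n + 2) → ℝ)) (hsymm : ∀ u v, B u v = B v u)
    (e : Fin (n + 2) → (Fin (n + 2) → ℝ)) (he : LinearIndependent ℝ e)
    (hgram : ∀ i j, B (e i) (e j) = gram n i j)
    (s : Fin m → (Fin m → ℤ) → (Fin (n + 2) → ℝ))
    (Φ : (Fin m → ℤ) → CliffordAlgebra (Qneg B))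
    (hframe : IsDiscreteFrame hmn B e s Φ)
    (t : Fin m → ℤ) (i j : Fin m) (hij : i ≠ j)
    (hne : B (e 0) (s j t) * B (e 0) (s j (t + Pi.single i 1)) ≠ 0) :
    (B (e 0) (s j t) * B (e 0) (s j (t + Pi.single i 1))) •
        (Fnet B e Φ t * Fnet B e Φ (t + Pi.single i 1) *
            Fnet B e Φ (t + Pi.single i 1 + Pi.single j 1) * Fnet B e Φ (t + Pi.single j 1) +
          Fnet B e Φ (t + Pi.single j 1) * Fnet B e Φ (t + Pi.single i 1 + Pi.single j 1) *
            Fnet B e Φ (t + Pi.single i 1) * Fnet B e Φ t) =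
      (-(B (e 0) (s i t) * B (e 0) (s i (t + Pi.single j 1)))) •
        ((Fnet B e Φ t * Fnet B e Φ (t + Pi.single j 1) +
            Fnet B e Φ (t + Pi.single j 1) * Fnet B e Φ t) *
          (Fnet B e Φ (t + Pi.single i 1) * Fnet B e Φ (t + Pi.single i 1 + Pi.single j 1) +
            Fnet B e Φ (t + Pi.single i 1 + Pi.single j 1) * Fnet B e Φ (t + Pi.single i 1))) := by
  obtain ⟨h0, hsq, hstep⟩ := hframe
  have hidx0 : ∀ k : Fin m, idx hmn k ≠ 0 := fun k h => by simp [idx, Fin.ext_iff] at h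
  have hidxl : ∀ k : Fin m, idx hmn k ≠ Fin.last (n + 1) := fun k h => by
    simp [idx, Fin.ext_iff] at h
    omega
  have hidxij : idx hmn j ≠ idx hmn i := fun h => hij (by
    simp [idx, Fin.ext_iff] at h
    exact Fin.ext h.symm)
  have comm := ι_Qneg_mul_comm B hsymm
  have ho : ι (Qneg B) (e 0) * ι (Qneg B) (e 0) = 0 := by
    rw [ι_Qneg_sq, hgram]
    simp [gram, Fin.ext_iff]
  have hesq : ∀ k : Fin m, ι (Qneg B) (e (idx hmn k)) * ι (Qneg B) (e (idx hmn k)) = -1 := by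
    intro k
    rw [ι_Qneg_sq, hgram]
    simp [gram, hidx0, hidxl]
  have heo : ∀ k : Fin m, ι (Qneg B) (e (idx hmn k)) * ι (Qneg B) (e 0) =
      -(ι (Qneg B) (e 0) * ι (Qneg B) (e (idx hmn k))) := by
    intro k
    rw [comm, hgram]
    simp [gram, hidx0, hidxl]
  have hba : ι (Qneg B) (e (idx hmn j)) * ι (Qneg B) (e (idx hmn i)) =
      -(ι (Qneg B) (e (idx hmn i)) * ι (Qneg B) (e (idx hmn j))) := by
    rw [comm, hgram]
    simp [gram, hidx0, hidxij]
  have hgg' : ∀ k t, ι (Qneg B) (e (idx hmn k)) * ι (Qneg B) (s k t) *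
      (ι (Qneg B) (s k t) * ι (Qneg B) (e (idx hmn k))) = 1 := fun k t => by
    linear_combination (norm := noncomm_ring) ι (Qneg B) (e (idx hmn k)) * hsq k t *
      ι (Qneg B) (e (idx hmn k)) - hesq k
  have hg'g : ∀ k t, ι (Qneg B) (s k t) * ι (Qneg B) (e (idx hmn k)) *
      (ι (Qneg B) (e (idx hmn k)) * ι (Qneg B) (s k t)) = 1 := fun k t => by
    linear_combination (norm := noncomm_ring) ι (Qneg B) (s k t) * hesq k *
      ι (Qneg B) (s k t) - hsq k t
  obtain ⟨u, hu⟩ := isUnit_of_step Φ h0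
    (fun t k => ⟨⟨_, _, hgg' k t, hg'g k t⟩, hstep t k⟩) t
  have hcomp : ι (Qneg B) (e (idx hmn j)) * ι (Qneg B) (s j (t + Pi.single i 1)) *
      ι (Qneg B) (e (idx hmn i)) * ι (Qneg B) (s i t) =
      ι (Qneg B) (e (idx hmn i)) * ι (Qneg B) (s i (t + Pi.single j 1)) *
      ι (Qneg B) (e (idx hmn j)) * ι (Qneg B) (s j t) := by
    have h := hstep (t + Pi.single i 1) j
    rw [add_right_comm, hstep (t + Pi.single j 1) i, hstep, hstep, ← hu] at h
    simp only [← mul_assoc] at h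
    exact (u.mul_left_inj.mp h).symm
  have hF1 : Fnet B e Φ t = ↑u⁻¹ * ι (Qneg B) (e 0) * u := by
    rw [Fnet, ← hu, Ring.inverse_unit]
  have hF : ∀ k, Fnet B e Φ (t + Pi.single k 1) =
      ↑u⁻¹ * (ι (Qneg B) (s k t) * ι (Qneg B) (e 0) * ι (Qneg B) (s k t)) * u := fun k => by
    rw [Fnet_eq_conj B e Φ u hu.symm (hgg' k t) (hg'g k t) (hstep t k)]
    congr 2
    linear_combination (norm := noncomm_ring)
      ι (Qneg B) (s k t) * heo k * ι (Qneg B) (e (idx hmn k)) * ι (Qneg B) (s k t) -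
      ι (Qneg B) (s k t) * ι (Qneg B) (e 0) * hesq k * ι (Qneg B) (s k t)
  have hF' : ∀ k l, Fnet B e Φ (t + Pi.single k 1 + Pi.single l 1) =
      ↑u⁻¹ * (ι (Qneg B) (s k t) * ι (Qneg B) (e (idx hmn k)) *
        (ι (Qneg B) (s l (t + Pi.single k 1)) * ι (Qneg B) (e 0) *
          ι (Qneg B) (s l (t + Pi.single k 1))) *
        ι (Qneg B) (e (idx hmn k)) * ι (Qneg B) (s k t)) * u := fun k l => by
    have h := hstep (t + Pi.single k 1) l
    rw [hstep t k, ← mul_assoc] at h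
    have hl := hgg' l (t + Pi.single k 1)
    have hl' := hg'g l (t + Pi.single k 1)
    have hk := hgg' k t
    have hk' := hg'g k t
    rw [Fnet_eq_conj B e Φ u hu.symm
      (g' := ι (Qneg B) (s k t) * ι (Qneg B) (e (idx hmn k)) *
        (ι (Qneg B) (s l (t + Pi.single k 1)) * ι (Qneg B) (e (idx hmn l)))) ?_ ?_ h]
    · congr 2
      generalize ι (Qneg B) (s k t) = x, ι (Qneg B) (s l (t + Pi.single k 1)) = y
      linear_combination (norm := noncomm_ring)
        x * ι (Qneg B) (e (idx hmn k)) * y * heo l * ι (Qneg B) (e (idx hmn l)) * y *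
          ι (Qneg B) (e (idx hmn k)) * x -
        x * ι (Qneg B) (e (idx hmn k)) * y * ι (Qneg B) (e 0) * hesq l * y *
          ι (Qneg B) (e (idx hmn k)) * x
    · rw [mul_assoc, ← mul_assoc _ _ (_ * ι (Qneg B) (e (idx hmn l))), hk, one_mul, hl]
    · rw [mul_assoc, ← mul_assoc _ _ (_ * ι (Qneg B) (s k t)), hl', one_mul, hk']
  have hprod := quadrilateral_product ho (hesq i) (hesq j) (heo i) (heo j) hba (hsq i t) (hsq j t)
    (hsq i (t + Pi.single j 1)) (hsq j (t + Pi.single i 1)) (comm _ _) (comm _ _) (comm _ _) hcomp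
  have hrev := congrArg (reverse (Q := Qneg B)) hprod
  simp only [reverse.map_mul, reverse_ι, map_smul, ← mul_assoc] at hrev
  have h14 := isotropic_reflect_anticommutator ho (hsq j t) (comm (e 0) (s j t))
  have h23 := edge_anticommutator ho (hesq i) (heo i) (hsq i t) (hsq j (t + Pi.single i 1))
    (comm (e 0) (s j (t + Pi.single i 1)))
  have conj_mul : ∀ x y : CliffordAlgebra (Qneg B),
      (↑u⁻¹ * x * u) * (↑u⁻¹ * y * u) = ↑u⁻¹ * (x * y) * u := fun x y => by
    simp [mul_assoc]
  have conj_add : ∀ x y : CliffordAlgebra (Qneg B),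
      (↑u⁻¹ * x * u) + (↑u⁻¹ * y * u) = ↑u⁻¹ * (x + y) * u := fun x y => by
    rw [mul_add, add_mul]
  have hleft : Fnet B e Φ t * Fnet B e Φ (t + Pi.single i 1) *
      Fnet B e Φ (t + Pi.single i 1 + Pi.single j 1) * Fnet B e Φ (t + Pi.single j 1) +
      Fnet B e Φ (t + Pi.single j 1) * Fnet B e Φ (t + Pi.single i 1 + Pi.single j 1) *
      Fnet B e Φ (t + Pi.single i 1) * Fnet B e Φ t =
      (-16 * (B (e 0) (s i t) * B (e 0) (s i (t + Pi.single j 1)) *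
        B (e 0) (s j (t + Pi.single i 1)) * B (e 0) (s j t))) • 1 := by
    rw [add_right_comm t, hF1, hF, hF, hF', conj_mul, conj_mul, conj_mul, conj_mul, conj_mul,
      conj_mul, conj_add, hprod]
    simp only [← mul_assoc]
    rw [hrev, comm (e 0) (s j t), ← smul_add, sub_add_eq_add_sub, neg_add_cancel, zero_sub,
      smul_neg, smul_smul, ← neg_smul]
    simp only [mul_smul_comm, smul_mul_assoc, mul_one, Units.inv_mul]
    congr 1
    ring
  rw [hleft, hF1, hF, hF, hF', conj_mul, conj_mul, conj_mul, conj_mul, conj_add, conj_add, h14, h23]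
  simp only [mul_smul_comm, smul_mul_assoc, mul_one, Units.inv_mul, smul_smul]
  congr 1
  ring
end
end

section
/- Fix a pseudo-orthonormal basis (e₀,e₁,…,e_n,e_∞) of Minkowski space ℝ^{n+2}_1 and let 1 ≤ m ≤ n. Suppose that for each t ∈ ℤ^m and 1 ≤ j ≤ m a vector S_j(t) ∈ ℝ^{n+2} with S_j(t)² = −1 is given. Then there exists a map Φ : ℤ^m → 𝒞, taking invertible values, with Φ(0) = 1 and Φ(t)⁻¹ e_j Φ(t+t_j) = S_j(t) for all t ∈ ℤ^m and 1 ≤ j ≤ m, if and only if the Maurer–Cartan equations 0 = S_i(t)·S_j(t+t_i) + S_j(t)·S_i(t+t_j) hold in 𝒞 for all t ∈ ℤ^m and all 1 ≤ i ≠ j ≤ m. -/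
open CliffordAlgebra

noncomputable section

variable {n m : ℕ}

/-- A compatible family of bijections on the edges of `ℤ^ι` integrates to a map on the vertices. -/
theorem exists_lattice_integral {ι X : Type*} [Fintype ι] [DecidableEq ι]
    (T : ι → (ι → ℤ) → Equiv.Perm X)
    (hT : ∀ t i j, i ≠ j →
      T j (t + Pi.single i 1) * T i t = T i (t + Pi.single j 1) * T j t) (x₀ : X) :
    ∃ Φ : (ι → ℤ) → X, Φ 0 = x₀ ∧ ∀ t j, Φ (t + Pi.single j 1) = T j t (Φ t) := by
  let σ : ι → Equiv.Perm ((_ : ι → ℤ) × X) := fun j =>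
    (Equiv.sigmaCongrRight (T j)).trans
      (Equiv.sigmaCongrLeft (β := fun _ => X) (Equiv.addRight (Pi.single j (1 : ℤ))))
  have σ_apply : ∀ j t x, σ j ⟨t, x⟩ = ⟨t + Pi.single j 1, T j t x⟩ := fun _ _ _ => rfl
  have hcomm : Pairwise fun i j => ∀ x y,
      Commute (zpowersHom _ (σ i) x) (zpowersHom _ (σ j) y) := by
    intro i j hij x y
    simp only [zpowersHom_apply]
    refine Commute.zpow_zpow ?_ _ _
    ext1 ⟨t, x⟩
    have h := congrArg (fun f : Equiv.Perm X => f x) (hT t j i hij.symm)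
    simp only [Equiv.Perm.mul_apply] at h
    simp only [Equiv.Perm.mul_apply, σ_apply, h, add_right_comm]
  let Θ := MonoidHom.noncommPiCoprod (fun j => zpowersHom _ (σ j)) hcomm
  have Θ_single : ∀ j k, Θ (Pi.mulSingle j k) = σ j ^ k.toAdd := fun j k => by
    simp [Θ, MonoidHom.noncommPiCoprod_mulSingle]
  have fst_zpow : ∀ j (k : ℤ) p, ((σ j ^ k) p).1 = p.1 + Pi.single j k := by
    have fst_σ : ∀ j p, (σ j p).1 = p.1 + Pi.single j 1 := fun _ _ => rfl
    intro j k
    induction k with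
    | zero => simp
    | succ k ih =>
      intro p
      rw [add_comm, zpow_add, Equiv.Perm.mul_apply, zpow_one, fst_σ, ih, Pi.single_add]
      abel
    | pred k ih =>
      intro p
      have h := fst_σ j ((σ j ^ (-(k : ℤ) - 1)) p)
      rw [← Equiv.Perm.mul_apply, ← zpow_one_add, add_sub_cancel, ih] at h
      rw [Pi.single_sub, ← add_sub_assoc, h, add_sub_cancel_right]
  have fst_Θ : ∀ (θ : ι → Multiplicative ℤ) p, (Θ θ p).1 = p.1 + fun i => (θ i).toAdd := by
    intro θ
    rw [← Finset.univ_prod_mulSingle θ]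
    refine Finset.prod_induction _ (fun θ => ∀ p, (Θ θ p).1 = p.1 + fun i => (θ i).toAdd)
      ?_ ?_ ?_
    · intro a b ha hb p
      rw [map_mul, Equiv.Perm.mul_apply, ha, hb]
      ext i
      simp only [Pi.add_apply, Pi.mul_apply, toAdd_mul]
      ring
    · intro p
      ext i
      simp
    · intro j _ p
      rw [Θ_single, fst_zpow]
      rfl
  refine ⟨fun t => (Θ (fun i => .ofAdd (t i)) ⟨0, x₀⟩).2, ?_, fun t j => ?_⟩
  · have : (fun i : ι => Multiplicative.ofAdd ((0 : ι → ℤ) i)) = 1 := rfl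
    beta_reduce
    rw [this, map_one, Equiv.Perm.one_apply]
  · have h : (fun i => Multiplicative.ofAdd ((t + Pi.single j 1 : ι → ℤ) i)) =
        Pi.mulSingle j (.ofAdd 1) * fun i => Multiplicative.ofAdd (t i) := by
      ext i
      by_cases h : i = j
      · subst h; simp [mul_comm]
      · simp [h]
    have ht := fst_Θ (fun i => .ofAdd (t i)) ⟨0, x₀⟩
    simp only [toAdd_ofAdd, zero_add] at ht
    beta_reduce
    rw [h, map_mul, Θ_single, Equiv.Perm.mul_apply, toAdd_ofAdd, zpow_one]
    change T j (Θ _ _).1 _ = _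
    rw [ht]

/-- The Maurer–Cartan equations characterise integrability, for edge labels and anticommuting
coefficients squaring to `-1` in an arbitrary ring. -/
theorem exists_frame_iff_maurerCartan {ι A : Type*} [Fintype ι] [DecidableEq ι] [Ring A]
    (e : ι → A) (he : ∀ j, e j * e j = -1) (hanti : ∀ i j, i ≠ j → e i * e j = -(e j * e i))
    (S : ι → (ι → ℤ) → A) (hS : ∀ j t, S j t * S j t = -1) :
    (∃ Φ : (ι → ℤ) → A, (∀ t, IsUnit (Φ t)) ∧ Φ 0 = 1 ∧
      ∀ t j, Ring.inverse (Φ t) * e j * Φ (t + Pi.single j 1) = S j t) ↔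
    ∀ t i j, i ≠ j →
      S i t * S j (t + Pi.single i 1) + S j t * S i (t + Pi.single j 1) = 0 := by
  constructor
  · rintro ⟨Φ, hu, -, hΦ⟩ t i j hij
    have key : ∀ i j, S i t * S j (t + Pi.single i 1) =
        Ring.inverse (Φ t) * (e i * e j) * Φ (t + Pi.single i 1 + Pi.single j 1) := by
      intro i j
      rw [← hΦ, ← hΦ]
      simp only [mul_assoc]
      rw [Ring.mul_inverse_cancel_left _ _ (hu _)]
    rw [key, key, hanti i j hij, add_right_comm t]
    noncomm_ring
  · intro hMC
    let u : ι → Aˣ := fun j => ⟨-e j, e j, by simp [he], by simp [he]⟩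
    let s : ι → (ι → ℤ) → Aˣ := fun j t => ⟨S j t, -S j t, by simp [hS], by simp [hS]⟩
    obtain ⟨Φ, h0, hΦ⟩ := exists_lattice_integral
      (fun j t => (Equiv.mulLeft (u j)).trans (Equiv.mulRight (s j t)))
      (by
        intro t i j hij
        ext x
        have h := eq_neg_of_add_eq_zero_left (hMC t i j hij)
        have h' := hanti j i hij.symm
        calc -e j * (-e i * x * S i t) * S j (t + Pi.single i 1)
            = e j * e i * x * (S i t * S j (t + Pi.single i 1)) := by noncomm_ring
          _ = -e i * (-e j * x * S j t) * S i (t + Pi.single j 1) := by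
            rw [h, h']; noncomm_ring) 1
    refine ⟨fun t => Φ t, fun t => (Φ t).isUnit, by simp [h0], fun t j => ?_⟩
    have h : ((Φ (t + Pi.single j 1) : Aˣ) : A) = -e j * Φ t * S j t := by
      rw [hΦ]; rfl
    beta_reduce
    rw [h, Ring.inverse_unit]
    calc _ = ((Φ t)⁻¹ : Aˣ) * (-(e j * e j)) * Φ t * S j t := by noncomm_ring
      _ = _ := by simp [he]

/-- **Maurer–Cartan equations.** Given unit vectors
`S_j(t) ∈ ℝ^{n+2}` (`S_j(t)² = −1` in `𝒞`) for `t ∈ ℤ^m`, `1 ≤ j ≤ m`, there exists a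
map `Φ : ℤ^m → 𝒞` with invertible values, `Φ(0) = 1` and
`Φ(t)⁻¹ e_j Φ(t+t_j) = S_j(t)` for all `t` and `j`, if and only if the Maurer–Cartan
equations `0 = S_i(t)·S_j(t+t_i) + S_j(t)·S_i(t+t_j)` hold in `𝒞` for all `t` and all
`i ≠ j`. -/
theorem stmt15 {n m : ℕ} (hm : 1 ≤ m) (hmn : m ≤ n)
    (B : LinearMap.BilinForm ℝ (Fin (n + 2) → ℝ)) (hsymm : ∀ u v, B u v = B v u)
    (e : Fin (n + 2) → (Fin (n + 2) → ℝ)) (he : LinearIndependent ℝ e)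
    (hgram : ∀ i j, B (e i) (e j) = gram n i j)
    (S : Fin m → (Fin m → ℤ) → (Fin (n + 2) → ℝ))
    (hS : ∀ (j : Fin m) (t : Fin m → ℤ),
      ι (Qneg B) (S j t) * ι (Qneg B) (S j t) = -1) :
    (∃ Φ : (Fin m → ℤ) → CliffordAlgebra (Qneg B),
      (∀ t, IsUnit (Φ t)) ∧ Φ 0 = 1 ∧
      (∀ (t : Fin m → ℤ) (j : Fin m),
        Ring.inverse (Φ t) * ι (Qneg B) (e (idx hmn j)) * Φ (t + Pi.single j 1) =
          ι (Qneg B) (S j t))) ↔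
    (∀ (t : Fin m → ℤ) (i j : Fin m), i ≠ j →
      ι (Qneg B) (S i t) * ι (Qneg B) (S j (t + Pi.single i 1)) +
        ι (Qneg B) (S j t) * ι (Qneg B) (S i (t + Pi.single j 1)) = 0) := by
  refine exists_frame_iff_maurerCartan _ (fun j => ?_) (fun i j hij => ?_) _ hS
  · have hne : idx hmn j ≠ Fin.last (n + 1) := by
      have := j.isLt
      simp only [idx, ne_eq, Fin.ext_iff, Fin.val_last]
      omega
    have hne' : idx hmn j ≠ 0 := by simp [idx, Fin.ext_iff]
    have hQ : Qneg B (e (idx hmn j)) = -1 := by simp [Qneg, hgram, gram, hne, hne']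
    rw [ι_sq_scalar, hQ, map_neg, map_one]
  · have hne : idx hmn i ≠ idx hmn j := by
      simpa [idx, Fin.ext_iff] using hij
    have hi : idx hmn i ≠ 0 := by simp [idx, Fin.ext_iff]
    have hj : idx hmn j ≠ 0 := by simp [idx, Fin.ext_iff]
    have hQ : QuadraticMap.polar (Qneg B) (e (idx hmn i)) (e (idx hmn j)) = 0 := by
      simp [Qneg, QuadraticMap.polar, hgram, gram, hi, hj, hne, hne.symm]
    rw [eq_neg_iff_add_eq_zero, ι_mul_ι_add_swap, hQ, map_zero]
end
end
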